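/- arXiv:1210.0882 — 2 statements merged into one kernel-verified Lean document; each statement's English description precedes it below -/
import Mathlib

section
/- Let c > 1. Then the series b_c := Σ_{n=1}^∞ μ(n) T_{log n} converges in operator norm (where μ is the Möbius function), and b_c is a two-sided inverse of the spectral operator a_c = Σ_{n=1}^∞ T_{log n}: a_c ∘ b_c = b_c ∘ a_c = Id on H_c. In particular, for c > 1 the spectral operator a_c is invertible in the algebra of bounded linear operators on H_c, so 0 does not belong to σ(a_c). -/
open MeasureTheory Filter Topology

/-- The weighted measure `e^{-2ct} dt` on the real line, defining the
weighted Hilbert space `H_c = L²(ℝ, e^{-2ct} dt)`. -/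
noncomputable def mu (c : ℝ) : Measure ℝ :=
  volume.withDensity fun t => ENNReal.ofReal (Real.exp (-2 * c * t))

/-- The weighted Hilbert space `H_c = L²(ℝ, e^{-2ct} dt)`. -/
noncomputable abbrev Hc (c : ℝ) : Type := Lp ℂ 2 (mu c)

/-- `T` acts on `H_c` as the translation operator `(T f)(u) = f(u - t)`. -/
def IsTranslation (c t : ℝ) (T : Hc c →L[ℂ] Hc c) : Prop :=
  ∀ f : Hc c, (T f : ℝ → ℂ) =ᵐ[mu c] fun u => (f : ℝ → ℂ) (u - t)

open scoped ArithmeticFunction.Moebius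

/-- The translation `u ↦ u - t` scales the weighted measure by `e^{-2ct}`. -/
theorem map_sub_right_mu (c t : ℝ) :
    (mu c).map (fun u => u - t) = ENNReal.ofReal (Real.exp (-2 * c * t)) • mu c := by
  have hw : Measurable fun t : ℝ => ENNReal.ofReal (Real.exp (-2 * c * t)) := by fun_prop
  have hsub : Measurable fun u : ℝ => u - t := by fun_prop
  ext s hs
  rw [Measure.map_apply hsub hs, Measure.smul_apply, mu, withDensity_apply _ (hsub hs),
    withDensity_apply _ hs, smul_eq_mul, ← lintegral_const_mul _ hw,
    ← (measurePreserving_sub_right volume t).setLIntegral_comp_preimage hs (by fun_prop)]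
  refine lintegral_congr fun u => ?_
  rw [← ENNReal.ofReal_mul (Real.exp_pos _).le, ← Real.exp_add]
  ring_nf

theorem quasiMeasurePreserving_sub_right_mu (c t : ℝ) :
    Measure.QuasiMeasurePreserving (fun u : ℝ => u - t) (mu c) (mu c) :=
  ⟨by fun_prop, by rw [map_sub_right_mu]; exact Measure.smul_absolutelyContinuous⟩

theorem eLpNorm_comp_sub_right_mu (c t : ℝ) {f : ℝ → ℂ} (hf : AEStronglyMeasurable f (mu c)) :
    eLpNorm (fun u => f (u - t)) 2 (mu c) =
      ENNReal.ofReal (Real.exp (-c * t)) * eLpNorm f 2 (mu c) := by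
  have hsub : Measurable fun u : ℝ => u - t := by fun_prop
  have hf' : AEStronglyMeasurable f ((mu c).map fun u => u - t) := by
    rw [map_sub_right_mu]
    exact hf.mono_ac Measure.smul_absolutelyContinuous
  have h := eLpNorm_map_measure (p := 2) hf' hsub.aemeasurable
  rw [map_sub_right_mu, eLpNorm_smul_measure_of_ne_top (by simp)] at h
  rw [Function.comp_def] at h
  rw [← h, smul_eq_mul, ENNReal.ofReal_rpow_of_pos (Real.exp_pos _), ← Real.exp_mul]
  congr 3
  simp
  ring

theorem memLp_comp_sub_right_mu (c t : ℝ) {f : ℝ → ℂ} (hf : MemLp f 2 (mu c)) :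
    MemLp (fun u => f (u - t)) 2 (mu c) := by
  refine ⟨hf.1.comp_quasiMeasurePreserving (quasiMeasurePreserving_sub_right_mu c t), ?_⟩
  rw [eLpNorm_comp_sub_right_mu c t hf.1]
  exact ENNReal.mul_lt_top ENNReal.ofReal_lt_top hf.2

/-- The class of `u ↦ f (u - t)` in `H_c`. -/
noncomputable def translateLp (c t : ℝ) (f : Hc c) : Hc c :=
  (memLp_comp_sub_right_mu c t (Lp.memLp f)).toLp _

theorem coeFn_translateLp (c t : ℝ) (f : Hc c) :
    (translateLp c t f : ℝ → ℂ) =ᵐ[mu c] fun u => (f : ℝ → ℂ) (u - t) :=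
  MemLp.coeFn_toLp _

theorem norm_translateLp (c t : ℝ) (f : Hc c) :
    ‖translateLp c t f‖ = Real.exp (-c * t) * ‖f‖ := by
  rw [translateLp, Lp.norm_toLp, eLpNorm_comp_sub_right_mu c t (Lp.aestronglyMeasurable f),
    ENNReal.toReal_mul, ENNReal.toReal_ofReal (Real.exp_pos _).le, Lp.norm_def]

theorem translateLp_add (c t : ℝ) (f g : Hc c) :
    translateLp c t (f + g) = translateLp c t f + translateLp c t g := by
  refine Lp.ext ?_
  filter_upwards [coeFn_translateLp c t (f + g), coeFn_translateLp c t f, coeFn_translateLp c t g,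
    Lp.coeFn_add (translateLp c t f) (translateLp c t g),
    (quasiMeasurePreserving_sub_right_mu c t).ae (Lp.coeFn_add f g)] with u h₁ h₂ h₃ h₄ h₅
  rw [h₁, h₄, h₅, Pi.add_apply, Pi.add_apply, h₂, h₃]

theorem translateLp_smul (c t : ℝ) (a : ℂ) (f : Hc c) :
    translateLp c t (a • f) = a • translateLp c t f := by
  refine Lp.ext ?_
  filter_upwards [coeFn_translateLp c t (a • f), coeFn_translateLp c t f,
    Lp.coeFn_smul a (translateLp c t f),
    (quasiMeasurePreserving_sub_right_mu c t).ae (Lp.coeFn_smul a f)] with u h₁ h₂ h₃ h₄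
  rw [h₁, h₃, h₄, Pi.smul_apply, Pi.smul_apply, h₂]

/-- The translation operator `T_t` on `H_c`. -/
noncomputable def translation (c t : ℝ) : Hc c →L[ℂ] Hc c :=
  LinearMap.mkContinuous
    { toFun := translateLp c t
      map_add' := translateLp_add c t
      map_smul' := translateLp_smul c t }
    (Real.exp (-c * t)) fun f => (norm_translateLp c t f).le

theorem isTranslation_translation (c t : ℝ) : IsTranslation c t (translation c t) :=
  coeFn_translateLp c t

theorem norm_translation_le (c t : ℝ) : ‖translation c t‖ ≤ Real.exp (-c * t) :=
  LinearMap.mkContinuous_norm_le _ (Real.exp_pos _).le _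

theorem translation_zero (c : ℝ) : translation c 0 = 1 := by
  ext1 f
  refine Lp.ext ((isTranslation_translation c 0 f).trans ?_)
  simp

theorem translation_add (c s t : ℝ) :
    translation c (s + t) = translation c s * translation c t := by
  ext1 f
  refine Lp.ext ((isTranslation_translation c (s + t) f).trans ?_)
  refine EventuallyEq.trans ?_ (isTranslation_translation c s (translation c t f)).symm
  have h := (quasiMeasurePreserving_sub_right_mu c s).ae_eq_comp (isTranslation_translation c t f)
  refine EventuallyEq.trans (Eventually.of_forall fun u => ?_) h.symm
  simp [sub_sub]

/-- Translation by `log n`, as a completely multiplicative function of `n`. -/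
noncomputable def translationLog (c : ℝ) : ℕ+ →* (Hc c →L[ℂ] Hc c) where
  toFun n := translation c (Real.log n)
  map_one' := by simp [translation_zero]
  map_mul' m n := by
    rw [← translation_add, PNat.mul_coe, Nat.cast_mul, Real.log_mul (by simp) (by simp)]

theorem summable_norm_translationLog {c : ℝ} (hc : 1 < c) :
    Summable fun n => ‖translationLog c n‖ := by
  have h : Summable fun n : ℕ+ => (n : ℝ) ^ (-c) :=
    (Real.summable_nat_rpow.mpr (by linarith)).comp_injective PNat.coe_injective
  refine h.of_nonneg_of_le (fun _ => norm_nonneg _) fun n => ?_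
  refine (norm_translation_le c (Real.log n)).trans_eq ?_
  rw [Real.rpow_def_of_pos (by simp), mul_comm]

/-- Dirichlet series inversion: the Möbius-twisted sum of a completely multiplicative, absolutely
summable function is inverse to the untwisted sum. -/
theorem tsum_mul_tsum_moebius {R : Type*} [NormedRing R] [NormedAlgebra ℂ R] [CompleteSpace R]
    (T : ℕ+ →* R) (hT : Summable fun n => ‖T n‖)
    (hμ : Summable fun n : ℕ+ => ‖((μ n : ℤ) : ℂ) • T n‖) :
    (∑' n, T n) * ∑' n : ℕ+, ((μ n : ℤ) : ℂ) • T n = 1 := by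
  rw [tsum_mul_tsum_of_summable_norm hT hμ, ← sigmaAntidiagonalEquivProd.tsum_eq]
  have hs := sigmaAntidiagonalEquivProd.summable_iff.mpr (summable_mul_of_summable_norm hT hμ)
  refine (hs.tsum_sigma).trans ?_
  have hfib (n : ℕ+) : ∑' d : (n : ℕ).divisorsAntidiagonal,
      (T (sigmaAntidiagonalEquivProd ⟨n, d⟩).1 *
        ((μ (sigmaAntidiagonalEquivProd ⟨n, d⟩).2 : ℤ) : ℂ) •
          T (sigmaAntidiagonalEquivProd ⟨n, d⟩).2) = if n = 1 then 1 else 0 := by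
    have hterm (d : (n : ℕ).divisorsAntidiagonal) :
        T (sigmaAntidiagonalEquivProd ⟨n, d⟩).1 *
          ((μ (sigmaAntidiagonalEquivProd ⟨n, d⟩).2 : ℤ) : ℂ) •
            T (sigmaAntidiagonalEquivProd ⟨n, d⟩).2 = ((μ d.1.2 : ℤ) : ℂ) • T n := by
      have hmul : (sigmaAntidiagonalEquivProd ⟨n, d⟩).1 *
          (sigmaAntidiagonalEquivProd ⟨n, d⟩).2 = n :=
        PNat.eq (Nat.mem_divisorsAntidiagonal.mp d.2).1
      rw [mul_smul_comm, ← map_mul, hmul]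
      rfl
    simp_rw [hterm]
    rw [tsum_fintype, ← Finset.sum_smul, Finset.sum_coe_sort _ fun d : ℕ × ℕ => ((μ d.2 : ℤ) : ℂ),
      Nat.sum_divisorsAntidiagonal' fun _ d => ((μ d : ℤ) : ℂ), ← Int.cast_sum,
      ← ArithmeticFunction.coe_mul_zeta_apply, ArithmeticFunction.moebius_mul_coe_zeta,
      ArithmeticFunction.one_apply]
    split_ifs with h h' h'
    · simp [h']
    · exact absurd (PNat.eq h) h'
    · simp [h'] at h
    · simp
  exact (tsum_congr hfib).trans (tsum_ite_eq _ _)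

/-- For `c > 1`, the series `b_c = Σ_{n≥1} μ(n) T_{log n}` (with `μ` the Möbius
function) converges in operator norm and is a two-sided inverse of the spectral
operator `a_c = Σ_{n≥1} T_{log n}`; in particular `a_c` is invertible in the
algebra of bounded operators on `H_c`, so `0 ∉ σ(a_c)`. -/
theorem spectralOperator_inverse_moebius (c : ℝ) (hc : 1 < c) :
    ∃ T : ℕ → Hc c →L[ℂ] Hc c,
      (∀ n : ℕ, IsTranslation c (Real.log ((n : ℝ) + 1)) (T n)) ∧
      ∃ A B : Hc c →L[ℂ] Hc c,
        HasSum T A ∧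
        HasSum (fun n : ℕ => ((ArithmeticFunction.moebius (n + 1) : ℤ) : ℂ) • T n) B ∧
        A * B = 1 ∧ B * A = 1 ∧ IsUnit A ∧ (0 : ℂ) ∉ spectrum ℂ A := by
  have hT := summable_norm_translationLog hc
  have hμ : Summable fun n : ℕ+ => ‖((μ n : ℤ) : ℂ) • translationLog c n‖ := by
    refine hT.of_nonneg_of_le (fun _ => norm_nonneg _) fun n => ?_
    rw [norm_smul]
    refine mul_le_of_le_one_left (norm_nonneg _) ?_
    rw [Complex.norm_intCast]
    exact_mod_cast ArithmeticFunction.abs_moebius_le_one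
  have hAB := tsum_mul_tsum_moebius (translationLog c) hT hμ
  have hcomm : Commute (∑' n, translationLog c n)
      (∑' n : ℕ+, ((μ n : ℤ) : ℂ) • translationLog c n) :=
    Commute.tsum_left _ fun m => Commute.tsum_right _ fun n =>
      ((Commute.all m n).map (translationLog c)).smul_right _
  have hBA := hcomm.eq.symm.trans hAB
  have hunit : IsUnit (∑' n, translationLog c n) := ⟨⟨_, _, hAB, hBA⟩, rfl⟩
  refine ⟨fun n => translationLog c n.succPNat, fun n => ?_, _, _,
    Equiv.pnatEquivNat.symm.hasSum_iff.mpr hT.of_norm.hasSum,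
    Equiv.pnatEquivNat.symm.hasSum_iff.mpr hμ.of_norm.hasSum, hAB, hBA, hunit,
    spectrum.zero_notMem_iff ℂ |>.mpr hunit⟩
  simpa [translationLog] using isTranslation_translation c (Real.log ((n : ℝ) + 1))
end

section
/- Let Ω be a bounded open subset of ℝ with infinitely many connected components, with component lengths l_1 ≥ l_2 ≥ ... > 0. Then the abscissa of convergence D := inf{σ ∈ ℝ : Σ_{j≥1} l_j^σ < ∞} equals the (inner) Minkowski dimension of the boundary ∂Ω: D = inf{α ≥ 0 : limsup_{ε→0⁺} vol₁(Ω_ε) · ε^{α−1} = 0}, where Ω_ε := {x ∈ Ω : dist(x, ∂Ω) < ε} and vol₁ is one-dimensional Lebesgue measure. -/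
open MeasureTheory Filter Topology Asymptotics

/-- An ordinary fractal string: a bounded open subset `Ω ⊆ ℝ` realized as a
countable disjoint union of (infinitely many) nonempty open intervals, whose
lengths `l_j = b_j - a_j` are listed in nonincreasing order. -/
structure FractalString where
  a : ℕ → ℝ
  b : ℕ → ℝ
  lt : ∀ j, a j < b j
  disj : Pairwise fun i j => Disjoint (Set.Ioo (a i) (b i)) (Set.Ioo (a j) (b j))
  bdd : Bornology.IsBounded (⋃ j, Set.Ioo (a j) (b j))
  anti : Antitone fun j => b j - a j

namespace FractalString

/-- The lengths `l_j` of the string. -/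
def l (S : FractalString) (j : ℕ) : ℝ := S.b j - S.a j

/-- The bounded open set `Ω ⊆ ℝ` of the string. -/
def Omega (S : FractalString) : Set ℝ := ⋃ j, Set.Ioo (S.a j) (S.b j)

/-- The inner `ε`-neighborhood `Ω_ε = {x ∈ Ω : dist(x, ∂Ω) < ε}` of `∂Ω`. -/
def innerNbhd (S : FractalString) (ε : ℝ) : Set ℝ :=
  {x ∈ S.Omega | Metric.infDist x (frontier S.Omega) < ε}

/-- The dimension of the string: the abscissa of convergence
`D = inf{σ : Σ_j l_j^σ < ∞}` of its geometric zeta function. -/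
noncomputable def dimension (S : FractalString) : ℝ :=
  sInf {σ : ℝ | Summable fun j => S.l j ^ σ}

/-- The spectral counting function `N_ν(x) = Σ_j ⌊l_j x⌋`. -/
noncomputable def Nnu (S : FractalString) (x : ℝ) : ℝ :=
  ∑' j : ℕ, (⌊S.l j * x⌋ : ℝ)

/-- The Weyl term `W(x) = vol₁(Ω)·x = (Σ_j l_j)·x`. -/
noncomputable def weyl (S : FractalString) (x : ℝ) : ℝ :=
  (∑' j : ℕ, S.l j) * x

/-- `vol₁(Ω_ε)/ε^{1-D} → M` as `ε → 0⁺`. -/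
def MinkTendsto (S : FractalString) (D M : ℝ) : Prop :=
  Tendsto (fun ε : ℝ => (volume (S.innerNbhd ε)).toReal / ε ^ (1 - D))
    (𝓝[>] 0) (𝓝 M)

/-- The string is Minkowski measurable of dimension `D`: the limit
`M = lim_{ε→0⁺} vol₁(Ω_ε)/ε^{1-D}` exists in `(0, ∞)`. -/
def MinkowskiMeasurable (S : FractalString) (D : ℝ) : Prop :=
  ∃ M, 0 < M ∧ S.MinkTendsto D M

/-- The geometric counting function `N_L(x) = #{j : l_j ≥ 1/x}`. -/
noncomputable def NL (S : FractalString) (x : ℝ) : ℕ :=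
  {j : ℕ | 1 / x ≤ S.l j}.ncard

end FractalString

namespace FractalString

lemma l_pos (S : FractalString) (j : ℕ) : 0 < S.l j := sub_pos.2 (S.lt j)

lemma isOpen_Omega (S : FractalString) : IsOpen S.Omega :=
  isOpen_iUnion fun _ => isOpen_Ioo

lemma summable_l (S : FractalString) : Summable S.l := by
  have h : ∑' j, ENNReal.ofReal (S.l j) ≠ ⊤ := by
    have hm := measure_iUnion (μ := volume) S.disj fun _ => measurableSet_Ioo
    simp only [Real.volume_Ioo] at hm
    exact hm ▸ S.bdd.measure_lt_top.ne
  simpa [ENNReal.toReal_ofReal, (S.l_pos _).le] using ENNReal.summable_toReal h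

lemma left_mem_frontier (S : FractalString) (j : ℕ) : S.a j ∈ frontier S.Omega := by
  rw [S.isOpen_Omega.frontier_eq]
  refine ⟨closure_mono (Set.subset_iUnion _ j) ?_, fun h => ?_⟩
  · rw [closure_Ioo (S.lt j).ne]
    exact Set.left_mem_Icc.2 (S.lt j).le
  · obtain ⟨i, hi⟩ := Set.mem_iUnion.1 h
    have hij : i ≠ j := by rintro rfl; exact lt_irrefl _ hi.1
    obtain ⟨x, hx, hx'⟩ := exists_between (lt_min hi.2 (S.lt j))
    exact Set.disjoint_left.1 (S.disj hij) ⟨hi.1.trans hx, hx'.trans_le (min_le_left _ _)⟩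
      ⟨hx, hx'.trans_le (min_le_right _ _)⟩

lemma min_le_infDist_frontier (S : FractalString) (j : ℕ) (x : ℝ) :
    min (x - S.a j) (S.b j - x) ≤ Metric.infDist x (frontier S.Omega) := by
  refine (Metric.le_infDist ⟨_, S.left_mem_frontier j⟩).2 fun y hy => ?_
  rw [S.isOpen_Omega.frontier_eq] at hy
  have hyj : y ∉ Set.Ioo (S.a j) (S.b j) := fun h => hy.2 (Set.mem_iUnion.2 ⟨j, h⟩)
  rw [Real.dist_eq]
  rcases le_or_gt y (S.a j) with h | h
  · exact (min_le_left _ _).trans (by linarith [le_abs_self (x - y)])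
  · have : S.b j ≤ y := not_lt.1 fun h' => hyj ⟨h, h'⟩
    exact (min_le_right _ _).trans (by linarith [neg_le_abs (x - y)])

lemma volume_innerNbhd_le (S : FractalString) {ε : ℝ} :
    volume (S.innerNbhd ε) ≤ ∑' j, ENNReal.ofReal (min (S.l j) (2 * ε)) := by
  rcases le_or_gt ε 0 with hε | hε
  · have : S.innerNbhd ε = ∅ := Set.eq_empty_of_forall_notMem fun x hx =>
      (hx.2.trans_le hε).not_ge Metric.infDist_nonneg
    simp [this]
  have hsub : S.innerNbhd ε ⊆ ⋃ j, Set.Ioo (S.a j) (S.b j) ∩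
      (Set.Ioo (S.a j) (S.a j + ε) ∪ Set.Ioo (S.b j - ε) (S.b j)) := by
    rintro x ⟨hx, hxε⟩
    obtain ⟨j, hj⟩ := Set.mem_iUnion.1 hx
    refine Set.mem_iUnion.2 ⟨j, hj, ?_⟩
    rcases min_lt_iff.1 ((S.min_le_infDist_frontier j x).trans_lt hxε) with h | h
    · exact Or.inl ⟨hj.1, by linarith⟩
    · exact Or.inr ⟨by linarith, hj.2⟩
  refine (measure_mono hsub).trans ((measure_iUnion_le _).trans (ENNReal.tsum_le_tsum fun j => ?_))
  rw [ENNReal.ofReal_min]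
  refine le_min ((measure_mono Set.inter_subset_left).trans_eq Real.volume_Ioo) ?_
  refine (measure_mono Set.inter_subset_right).trans ((measure_union_le _ _).trans_eq ?_)
  rw [Real.volume_Ioo, Real.volume_Ioo, two_mul, ENNReal.ofReal_add hε.le hε.le]
  congr 2 <;> ring

lemma le_volume_innerNbhd (S : FractalString) (j : ℕ) :
    ENNReal.ofReal ((j + 1) * S.l j) ≤ volume (S.innerNbhd (S.l j)) := by
  have hsub : ∀ i ∈ Finset.range (j + 1),
      Set.Ioo (S.a i) (S.a i + S.l j) ⊆ Set.Ioo (S.a i) (S.b i) := fun i hi =>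
    Set.Ioo_subset_Ioo_right <| by
      have : S.l j ≤ S.l i := S.anti (Finset.mem_range_succ_iff.1 hi)
      rw [l, l] at this; rw [l]; linarith
  have hle : (⋃ i ∈ Finset.range (j + 1), Set.Ioo (S.a i) (S.a i + S.l j)) ⊆
      S.innerNbhd (S.l j) := by
    refine Set.iUnion₂_subset fun i hi x hx => ⟨Set.mem_iUnion.2 ⟨i, hsub i hi hx⟩, ?_⟩
    refine (Metric.infDist_le_dist_of_mem (S.left_mem_frontier i)).trans_lt ?_
    rw [Real.dist_eq, abs_of_pos (by linarith [hx.1])]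
    linarith [hx.2]
  refine le_trans (le_of_eq ?_) (measure_mono hle)
  rw [measure_biUnion_finset (fun i hi k hk hik =>
    (S.disj hik).mono (hsub i hi) (hsub k hk)) fun _ _ => measurableSet_Ioo]
  simp only [Real.volume_Ioo, add_sub_cancel_left, Finset.sum_const, Finset.card_range,
    nsmul_eq_mul]
  rw [ENNReal.ofReal_mul (by positivity)]
  congr 1
  exact_mod_cast ENNReal.ofReal_natCast (j + 1)

lemma min_le_rpow_mul_rpow {x y σ : ℝ} (hx : 0 < x) (hy : 0 < y) (h0 : 0 ≤ σ) (h1 : σ ≤ 1) :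
    min x y ≤ x ^ σ * y ^ (1 - σ) := by
  have hm : 0 < min x y := lt_min hx hy
  calc min x y = min x y ^ σ * min x y ^ (1 - σ) := by
        rw [← Real.rpow_add hm, add_sub_cancel, Real.rpow_one]
    _ ≤ x ^ σ * y ^ (1 - σ) := by
        gcongr
        · exact min_le_left _ _
        · exact min_le_right _ _

lemma pos_of_summable (S : FractalString) {σ : ℝ} (h : Summable fun j => S.l j ^ σ) : 0 < σ := by
  by_contra! hσ
  have h1 := h.tendsto_atTop_zero.eventually_lt_const one_pos
  have h2 := S.summable_l.tendsto_atTop_zero.eventually_lt_const one_pos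
  obtain ⟨j, hj1, hj2⟩ := (h1.and h2).exists
  exact hj1.not_ge (Real.one_le_rpow_of_pos_of_le_one_of_nonpos (S.l_pos j) hj2.le hσ)

lemma limsup_eq_zero_of_summable (S : FractalString) {σ α : ℝ}
    (h : Summable fun j => S.l j ^ σ) (h1 : σ ≤ 1) (hα : σ < α) :
    limsup (fun ε : ℝ => volume (S.innerNbhd ε) / ENNReal.ofReal (ε ^ (1 - α))) (𝓝[>] 0) = 0 := by
  set C := ∑' j, S.l j ^ σ * 2 ^ (1 - σ)
  have hlim : Tendsto (fun ε : ℝ => ENNReal.ofReal (C * ε ^ (α - σ))) (𝓝[>] 0) (𝓝 0) := by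
    have : Tendsto (fun ε : ℝ => C * ε ^ (α - σ)) (𝓝 0) (𝓝 (C * 0 ^ (α - σ))) :=
      ((Real.continuousAt_rpow_const 0 _ (Or.inr (sub_pos.2 hα).le)).tendsto).const_mul C
    rw [Real.zero_rpow (sub_pos.2 hα).ne', mul_zero] at this
    simpa using ENNReal.tendsto_ofReal (this.mono_left nhdsWithin_le_nhds)
  refine (tendsto_of_tendsto_of_tendsto_of_le_of_le' tendsto_const_nhds hlim
    (Eventually.of_forall fun _ => zero_le) ?_).limsup_eq
  filter_upwards [self_mem_nhdsWithin] with ε hε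
  rw [Set.mem_Ioi] at hε
  have hpos : 0 < ε ^ (1 - α) := Real.rpow_pos_of_pos hε _
  refine ENNReal.div_le_of_le_mul ?_
  rw [← ENNReal.ofReal_mul' hpos.le, mul_assoc, ← Real.rpow_add hε]
  refine S.volume_innerNbhd_le.trans ?_
  rw [← tsum_mul_right, ENNReal.ofReal_tsum_of_nonneg
    (fun j => by have := S.l_pos j; positivity) ((h.mul_right _).mul_right _)]
  refine ENNReal.tsum_le_tsum fun j => ENNReal.ofReal_le_ofReal ?_
  refine (min_le_rpow_mul_rpow (S.l_pos j) (by positivity) (S.pos_of_summable h).le h1).trans_eq ?_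
  rw [Real.mul_rpow two_pos.le hε.le, mul_assoc]
  congr 3
  ring

lemma summable_of_limsup_eq_zero (S : FractalString) {α σ : ℝ} (hα : 0 ≤ α)
    (h : limsup (fun ε : ℝ => volume (S.innerNbhd ε) / ENNReal.ofReal (ε ^ (1 - α))) (𝓝[>] 0) = 0)
    (hσ : α < σ) : Summable fun j => S.l j ^ σ := by
  have htend : Tendsto S.l atTop (𝓝[>] 0) := tendsto_nhdsWithin_iff.2
    ⟨S.summable_l.tendsto_atTop_zero, Eventually.of_forall S.l_pos⟩
  have hbound : ∀ᶠ j : ℕ in atTop, S.l j ^ α ≤ ((j : ℝ) + 1)⁻¹ := by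
    filter_upwards [htend.eventually (eventually_lt_of_limsup_lt (h.trans_lt one_pos))] with j hj
    have hl := S.l_pos j
    have hpos : 0 < S.l j ^ (1 - α) := Real.rpow_pos_of_pos hl _
    have hle : volume (S.innerNbhd (S.l j)) ≤ ENNReal.ofReal (S.l j ^ (1 - α)) := by
      have := (ENNReal.div_le_iff (ENNReal.ofReal_pos.2 hpos).ne' ENNReal.ofReal_ne_top).1 hj.le
      rwa [one_mul] at this
    have hreal := (ENNReal.ofReal_le_ofReal_iff hpos.le).1 ((S.le_volume_innerNbhd j).trans hle)
    rw [Real.rpow_sub hl, Real.rpow_one, le_div_iff₀ (by positivity)] at hreal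
    rw [le_inv_comm₀ (by positivity) (by positivity), ← one_div, le_div_iff₀ (by positivity)]
    nlinarith
  rcases hα.eq_or_lt with rfl | hα
  · obtain ⟨j, hj, hj0⟩ := (hbound.and (eventually_gt_atTop 0)).exists
    rw [Real.rpow_zero, le_inv_comm₀ one_pos (by positivity), inv_one] at hj
    have : (0 : ℝ) < j := by exact_mod_cast hj0
    linarith
  · have hs : Summable fun j : ℕ => (((j + 1 : ℕ) : ℝ) ^ (σ / α))⁻¹ :=
      (summable_nat_add_iff 1).2 (Real.summable_nat_rpow_inv.2 ((one_lt_div hα).2 hσ))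
    refine hs.of_norm_bounded_eventually_nat ?_
    filter_upwards [hbound] with j hj
    have hl := S.l_pos j
    rw [Real.norm_of_nonneg (by positivity), ← Real.inv_rpow (by positivity),
      show S.l j ^ σ = (S.l j ^ α) ^ (σ / α) by
        rw [← Real.rpow_mul hl.le, mul_div_cancel₀ _ hα.ne']]
    push_cast
    exact Real.rpow_le_rpow (by positivity) hj (by have := hα.trans hσ; positivity)

end FractalString

/-- The abscissa of convergence `D = inf{σ : Σ_j l_j^σ < ∞}` of an ordinary
fractal string equals the (inner) Minkowski dimension of its boundary:
`D = inf{α ≥ 0 : limsup_{ε→0⁺} vol₁(Ω_ε)·ε^{α-1} = 0}`. -/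
theorem abscissa_eq_minkowskiDimension (S : FractalString) :
    S.dimension =
      sInf {α : ℝ | 0 ≤ α ∧
        Filter.limsup
          (fun ε : ℝ => volume (S.innerNbhd ε) / ENNReal.ofReal (ε ^ (1 - α)))
          (𝓝[>] 0) = 0} := by
  have hone : (1 : ℝ) ∈ {σ : ℝ | Summable fun j => S.l j ^ σ} := by
    simpa using S.summable_l
  have hA : BddBelow {σ : ℝ | Summable fun j => S.l j ^ σ} :=
    ⟨0, fun σ hσ => (S.pos_of_summable hσ).le⟩
  rw [FractalString.dimension]
  refine le_antisymm ?_ ?_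
  · refine le_csInf ⟨2, two_pos.le, S.limsup_eq_zero_of_summable hone le_rfl one_lt_two⟩ ?_
    rintro α ⟨hα, h⟩
    exact le_of_forall_gt_imp_ge_of_dense fun σ hσ =>
      csInf_le hA (S.summable_of_limsup_eq_zero hα h hσ)
  · refine le_csInf ⟨1, hone⟩ fun σ hσ => le_of_forall_gt_imp_ge_of_dense fun α hα => ?_
    refine csInf_le ⟨0, fun _ h => h.1⟩ ⟨(S.pos_of_summable hσ).le.trans hα.le, ?_⟩
    rcases le_total σ 1 with h1 | h1
    · exact S.limsup_eq_zero_of_summable hσ h1 hα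
    · exact S.limsup_eq_zero_of_summable hone le_rfl (h1.trans_lt hα)
end
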